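/- Existence of a deterministic AVC channel code for average error (Kosut–Kliewer bound): fix n, M ∈ ℕ, a function Z : 𝒳^n × 𝒳^n × 𝒴^n → {0,1} satisfying Z(x,x̄,y)·Z(x̄,x,y) = 0 for all x,x̄ ∈ 𝒳^n, y ∈ 𝒴^n, and a set 𝒜 ⊆ 𝒳^n × 𝒴^n. Then there exists a deterministic channel code (f,φ) with f : {1,…,M} → 𝒳^n, φ : 𝒴^n → {1,…,M} whose maximum-over-states average error satisfies ē(f,φ) ≤ √(2 ln(3|𝒯|^n)/M) + min_{P_X ∈ 𝒫(𝒳^n)} max_{θ ∈ 𝒯^n} [ ℙ((X,Y) ∉ 𝒜 | θ) + 2 log(3|𝒯|^n) · max_{x̄ ∈ 𝒳^n} ℙ(Z(X,x̄,Y)=0, (X,Y)∈𝒜 | θ) + 2M log e · ℙ(Z(X,X̄,Y)=0, (X,Y)∈𝒜 | θ) ], where given θ the triple (X,X̄,Y) has distribution P_X(x) P_X(x̄) P_{Y|X,Θ}(y|x,θ). -/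

import Mathlib

open scoped BigOperators
open Classical MeasureTheory Filter

noncomputable section

namespace AVCGame

/-- A probability mass function on a finite type, as a real-valued function. -/
def IsDist {α : Type*} [Fintype α] (p : α → ℝ) : Prop :=
  (∀ a, 0 ≤ p a) ∧ ∑ a, p a = 1

/-- The set of probability distributions on a finite type. -/
abbrev ProbDist (α : Type*) [Fintype α] := {p : α → ℝ // IsDist p}

/-- Conditional probability distributions (channels/kernels). -/
abbrev Kernel (α β : Type*) [Fintype β] := {Q : α → β → ℝ // ∀ a, IsDist (Q a)}

/-- Real-valued indicator of a proposition. -/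
def ind (P : Prop) : ℝ := if P then 1 else 0

variable {𝒮 𝒳 𝒴 𝒯 α β : Type*}

/-- Memoryless `n`-letter extension of a state-dependent channel. -/
def nCh (W : 𝒯 → 𝒳 → 𝒴 → ℝ) (n : ℕ) (θ : Fin n → 𝒯) (x : Fin n → 𝒳) (y : Fin n → 𝒴) : ℝ :=
  ∏ i, W (θ i) (x i) (y i)

/-- i.i.d. product distribution on `k`-letter strings. -/
def prodF (p : α → ℝ) (k : ℕ) (s : Fin k → α) : ℝ := ∏ i, p (s i)

/-- Block (per-letter averaged) distortion. -/
def dBlock (dS : 𝒮 → 𝒮 → ℝ) (k : ℕ) (s s' : Fin k → 𝒮) : ℝ := (∑ i, dS (s i) (s' i)) / k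

section Values

variable [Fintype 𝒮] [Fintype 𝒳] [Fintype 𝒴] [Fintype 𝒯]

/-- Probability of exceeding distortion `D` under a stochastic code and jammer distribution. -/
def errP (W : 𝒯 → 𝒳 → 𝒴 → ℝ) (PS : 𝒮 → ℝ) (dS : 𝒮 → 𝒮 → ℝ) (D : ℝ) (k n : ℕ)
    (QXS : (Fin k → 𝒮) → (Fin n → 𝒳) → ℝ)
    (QSY : (Fin n → 𝒴) → (Fin k → 𝒮) → ℝ)
    (q : (Fin n → 𝒯) → ℝ) : ℝ :=
  ∑ θ : Fin n → 𝒯, ∑ s : Fin k → 𝒮, ∑ x : Fin n → 𝒳, ∑ y : Fin n → 𝒴, ∑ s' : Fin k → 𝒮,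
    ind (dBlock dS k s s' > D) * q θ * prodF PS k s * QXS s x * nCh W n θ x y * QSY y s'

/-- Upper (minimax) value of the zero-sum game. -/
def upperVal (W : 𝒯 → 𝒳 → 𝒴 → ℝ) (PS : 𝒮 → ℝ) (dS : 𝒮 → 𝒮 → ℝ) (D : ℝ) (k n : ℕ) : ℝ :=
  ⨅ QXS : Kernel (Fin k → 𝒮) (Fin n → 𝒳), ⨅ QSY : Kernel (Fin n → 𝒴) (Fin k → 𝒮),
    ⨆ q : ProbDist (Fin n → 𝒯), errP W PS dS D k n QXS.1 QSY.1 q.1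

/-- Lower (maximin) value of the zero-sum game. -/
def lowerVal (W : 𝒯 → 𝒳 → 𝒴 → ℝ) (PS : 𝒮 → ℝ) (dS : 𝒮 → 𝒮 → ℝ) (D : ℝ) (k n : ℕ) : ℝ :=
  ⨆ q : ProbDist (Fin n → 𝒯), ⨅ QXS : Kernel (Fin k → 𝒮) (Fin n → 𝒳),
    ⨅ QSY : Kernel (Fin n → 𝒴) (Fin k → 𝒮), errP W PS dS D k n QXS.1 QSY.1 q.1

end Values

/-- Mutual information (base 2) between the input of a channel `Wc` with input law `P`
and the corresponding output. -/
def mutInfo [Fintype α] [Fintype β] (P : α → ℝ) (Wc : α → β → ℝ) : ℝ :=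
  ∑ x, ∑ y, P x * Wc x y * Real.logb 2 (Wc x y / ∑ x', P x' * Wc x' y)

/-- The single-letter channel averaged over a state distribution. -/
def avgCh [Fintype 𝒯] (W : 𝒯 → 𝒳 → 𝒴 → ℝ) (qθ : 𝒯 → ℝ) (x : 𝒳) (y : 𝒴) : ℝ :=
  ∑ θ, qθ θ * W θ x y

/-- Randomized-code capacity of the AVC: `max_P min_q I(X;Y_q)`. -/
def capacity [Fintype 𝒳] [Fintype 𝒴] [Fintype 𝒯] (W : 𝒯 → 𝒳 → 𝒴 → ℝ) : ℝ :=
  ⨆ P : ProbDist 𝒳, ⨅ q : ProbDist 𝒯, mutInfo P.1 (avgCh W q.1)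

/-- Capacity-achieving state distributions. -/
def PiTheta [Fintype 𝒳] [Fintype 𝒴] [Fintype 𝒯] (W : 𝒯 → 𝒳 → 𝒴 → ℝ) : Set (ProbDist 𝒯) :=
  {q | (⨆ P : ProbDist 𝒳, mutInfo P.1 (avgCh W q.1)) = capacity W}

/-- Capacity-achieving input distributions. -/
def PiX [Fintype 𝒳] [Fintype 𝒴] [Fintype 𝒯] (W : 𝒯 → 𝒳 → 𝒴 → ℝ) : Set (ProbDist 𝒳) :=
  {P | (⨅ q : ProbDist 𝒯, mutInfo P.1 (avgCh W q.1)) = capacity W}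

/-- Information density (base 2) of a channel `Wc` with input law `P`. -/
def infoDens [Fintype α] (P : α → ℝ) (Wc : α → β → ℝ) (x : α) (y : β) : ℝ :=
  Real.logb 2 (Wc x y / ∑ x', P x' * Wc x' y)

/-- Variance of the information density under the joint law `P × Wc`. -/
def varInfoDens [Fintype α] [Fintype β] (P : α → ℝ) (Wc : α → β → ℝ) : ℝ :=
  ∑ x, ∑ y, P x * Wc x y * (infoDens P Wc x y - mutInfo P Wc) ^ 2

/-- Channel dispersion (for a given, typically unique, capacity achieving state
distribution `qθ`): the minimum over capacity achieving inputs of the variance of the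
information density. -/
def VC [Fintype 𝒳] [Fintype 𝒴] [Fintype 𝒯] (W : 𝒯 → 𝒳 → 𝒴 → ℝ) (qθ : 𝒯 → ℝ) : ℝ :=
  ⨅ P : PiX W, varInfoDens P.1.1 (avgCh W qθ)

/-- Rate-distortion function of a source `P` with distortion measure `dist` at level `D`. -/
def RD [Fintype α] (P : α → ℝ) (dist : α → α → ℝ) (D : ℝ) : ℝ :=
  ⨅ K : {K : Kernel α α // ∑ a, ∑ b, P a * K.1 a b * dist a b ≤ D}, mutInfo P K.1.1

/-- `λ* = -R'(D)`. -/
def lamStar [Fintype α] (P : α → ℝ) (dist : α → α → ℝ) (D : ℝ) : ℝ :=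
  -(deriv (RD P dist) D)

/-- `K` is a minimizer in the rate-distortion problem. -/
def IsRDMinimizer [Fintype α] (P : α → ℝ) (dist : α → α → ℝ) (D : ℝ) (K : α → α → ℝ) : Prop :=
  (∀ a, IsDist (K a)) ∧ (∑ a, ∑ b, P a * K a b * dist a b ≤ D) ∧ mutInfo P K = RD P dist D

/-- Output marginal of a source `P` through a kernel `K`. -/
def outMarg [Fintype α] (P : α → ℝ) (K : α → α → ℝ) (b : α) : ℝ := ∑ a, P a * K a b

/-- The `D`-tilted information, defined from a rate-distortion minimizer `K`. -/
def dtilted [Fintype α] (P : α → ℝ) (dist : α → α → ℝ) (D : ℝ) (K : α → α → ℝ) (a : α) : ℝ :=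
  - Real.logb 2 (∑ b, outMarg P K b *
      (2 : ℝ) ^ (lamStar P dist D * D - lamStar P dist D * dist a b))

/-- Variance of `f` under the distribution `P`. -/
def varOf [Fintype α] (P : α → ℝ) (f : α → ℝ) : ℝ :=
  ∑ a, P a * (f a - ∑ b, P b * f b) ^ 2

/-- Finiteness of the `D`-tilted information: the expectation inside the logarithm is
strictly positive. -/
def TiltFinite [Fintype α] (P : α → ℝ) (dist : α → α → ℝ) (D : ℝ) (K : α → α → ℝ) : Prop :=
  ∀ a, 0 < ∑ b, outMarg P K b *
      (2 : ℝ) ^ (lamStar P dist D * D - lamStar P dist D * dist a b)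

/-- Finiteness of the single-letter information density `i(x;Y)` for every input
distribution: whenever the channel output probability is positive, so is the output
marginal. -/
def InfoDensFinite [Fintype 𝒳] [Fintype 𝒴] [Fintype 𝒯] (W : 𝒯 → 𝒳 → 𝒴 → ℝ)
    (qθ : 𝒯 → ℝ) : Prop :=
  ∀ (P : ProbDist 𝒳) (x : 𝒳) (y : 𝒴), 0 < avgCh W qθ x y → 0 < ∑ x', P.1 x' * avgCh W qθ x' y

/-- Symmetrizability of the AVC. -/
def Symmetrizable [Fintype 𝒯] (W : 𝒯 → 𝒳 → 𝒴 → ℝ) : Prop :=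
  ∃ σ : 𝒳 → 𝒯 → ℝ, (∀ x, IsDist (σ x)) ∧
    ∀ x x' y, ∑ θ, σ x θ * W θ x' y = ∑ θ, σ x' θ * W θ x y

/-- Complementary standard Gaussian CDF. -/
def Qc (t : ℝ) : ℝ := ∫ u in Set.Ioi t, Real.exp (-(u ^ 2) / 2) / Real.sqrt (2 * Real.pi)

/-- Inverse of the complementary standard Gaussian CDF. -/
def Qcinv (ε : ℝ) : ℝ := Function.invFun Qc ε

/-- `n`-letter channel averaged over a jammer distribution on state sequences. -/
def avgChnQ [Fintype 𝒯] (W : 𝒯 → 𝒳 → 𝒴 → ℝ) (n : ℕ) (q : (Fin n → 𝒯) → ℝ)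
    (x : Fin n → 𝒳) (y : Fin n → 𝒴) : ℝ :=
  ∑ θ : Fin n → 𝒯, q θ * nCh W n θ x y

/-- `n`-letter channel averaged over the i.i.d. extension of a single-letter state law. -/
def avgChn [Fintype 𝒯] (W : 𝒯 → 𝒳 → 𝒴 → ℝ) (qθ : 𝒯 → ℝ) (n : ℕ)
    (x : Fin n → 𝒳) (y : Fin n → 𝒴) : ℝ :=
  ∑ θ : Fin n → 𝒯, prodF qθ n θ * nCh W n θ x y

/-- Probability of the distortion ball `B_D(s)` under a distribution on `𝒮^k`. -/
def ballProb [Fintype 𝒮] (dS : 𝒮 → 𝒮 → ℝ) (D : ℝ) (k : ℕ)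
    (PShat : (Fin k → 𝒮) → ℝ) (s : Fin k → 𝒮) : ℝ :=
  ∑ s', ind (dBlock dS k s s' ≤ D) * PShat s'

/-- Error of a deterministic joint source-channel code against state sequence `θ`. -/
def eCode [Fintype 𝒮] [Fintype 𝒴] (W : 𝒯 → 𝒳 → 𝒴 → ℝ) (PS : 𝒮 → ℝ) (dS : 𝒮 → 𝒮 → ℝ)
    (D : ℝ) (k n : ℕ) (f : (Fin k → 𝒮) → Fin n → 𝒳) (φ : (Fin n → 𝒴) → Fin k → 𝒮)
    (θ : Fin n → 𝒯) : ℝ :=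
  ∑ s : Fin k → 𝒮, ∑ y : Fin n → 𝒴,
    ind (dBlock dS k s (φ y) > D) * prodF PS k s * nCh W n θ (f s) y

/-- Deterministic joint source-channel code pairs. -/
abbrev CodePair (𝒮 𝒳 𝒴 : Type*) (k n : ℕ) :=
  ((Fin k → 𝒮) → Fin n → 𝒳) × ((Fin n → 𝒴) → Fin k → 𝒮)

/-- Worst-case (over states) error of a random joint source-channel code `ψ`. -/
def eRandMax [Fintype 𝒮] [Fintype 𝒳] [Fintype 𝒴] [Fintype 𝒯]
    [DecidableEq 𝒮] [DecidableEq 𝒴]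
    (W : 𝒯 → 𝒳 → 𝒴 → ℝ) (PS : 𝒮 → ℝ) (dS : 𝒮 → 𝒮 → ℝ) (D : ℝ) (k n : ℕ)
    (ψ : CodePair 𝒮 𝒳 𝒴 k n → ℝ) : ℝ :=
  ⨆ θ : Fin n → 𝒯, ∑ c : CodePair 𝒮 𝒳 𝒴 k n, ψ c * eCode W PS dS D k n c.1 c.2 θ

/-- Kullback-Leibler divergence (base 2) between pmfs on a finite type. -/
def klDiv [Fintype α] (P Q : α → ℝ) : ℝ := ∑ a, P a * Real.logb 2 (P a / Q a)

/-- The reference measure `P_X × Q_{X'Θ} × P_{Y|X,Θ}` built from the `(x',θ)`-marginal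
of `Q`. -/
def refMeas [Fintype 𝒳] [Fintype 𝒴] [Fintype 𝒯] (W : 𝒯 → 𝒳 → 𝒴 → ℝ) (PX : 𝒳 → ℝ)
    (Q : 𝒳 × 𝒳 × 𝒯 × 𝒴 → ℝ) : 𝒳 × 𝒳 × 𝒯 × 𝒴 → ℝ :=
  fun p => PX p.1 * (∑ x : 𝒳, ∑ y : 𝒴, Q (x, p.2.1, p.2.2.1, y)) * W p.2.2.1 p.1 p.2.2.2

/-- The set `D_η` of joint distributions within divergence `η` of the reference measure. -/
def Dset [Fintype 𝒳] [Fintype 𝒴] [Fintype 𝒯] (W : 𝒯 → 𝒳 → 𝒴 → ℝ) (PX : 𝒳 → ℝ)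
    (η : ℝ) : Set (𝒳 × 𝒳 × 𝒯 × 𝒴 → ℝ) :=
  {Q | IsDist Q ∧ klDiv Q (refMeas W PX Q) ≤ η}

/-- `η*`: the infimum of `η ≥ 0` admitting a coupling whose two marginals lie in `D_η`. -/
def etaStar [Fintype 𝒳] [Fintype 𝒴] [Fintype 𝒯] (W : 𝒯 → 𝒳 → 𝒴 → ℝ) (PX : 𝒳 → ℝ) : ℝ :=
  sInf {η : ℝ | 0 ≤ η ∧ ∃ Q : 𝒳 × 𝒳 × 𝒯 × 𝒯 × 𝒴 → ℝ, IsDist Q ∧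
      (fun p : 𝒳 × 𝒳 × 𝒯 × 𝒴 =>
        ∑ θ' : 𝒯, Q (p.1, p.2.1, p.2.2.1, θ', p.2.2.2)) ∈ Dset W PX η ∧
      (fun p : 𝒳 × 𝒳 × 𝒯 × 𝒴 =>
        ∑ θ : 𝒯, Q (p.2.1, p.1, θ, p.2.2.1, p.2.2.2)) ∈ Dset W PX η}

/-- Joint type (empirical distribution) of four `d`-letter strings. -/
def jointType4 [Fintype 𝒳] [Fintype 𝒴] [Fintype 𝒯] (d : ℕ)
    (x xb : Fin d → 𝒳) (θ : Fin d → 𝒯) (y : Fin d → 𝒴) : 𝒳 × 𝒳 × 𝒯 × 𝒴 → ℝ :=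
  fun a => ((Finset.univ.filter (fun i : Fin d => (x i, xb i, θ i, y i) = a)).card : ℝ) / d

/-- `T` is a type (empirical distribution) of a `d`-letter state sequence. -/
def IsTypeOf [Fintype 𝒯] (d : ℕ) (T : 𝒯 → ℝ) : Prop :=
  ∃ θ : Fin d → 𝒯, ∀ t, T t = ((Finset.univ.filter (fun i : Fin d => θ i = t)).card : ℝ) / d

end AVCGame

open AVCGame Filter

namespace AVCGame

section RandomCode

variable {ι κ X Y Θ : Type*}

lemma ind_nonneg (p : Prop) : 0 ≤ ind p := by
  unfold ind; split_ifs <;> norm_num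

lemma ind_le_one (p : Prop) : ind p ≤ 1 := by
  unfold ind; split_ifs <;> norm_num

lemma ind_mono {p q : Prop} (h : p → q) : ind p ≤ ind q := by
  unfold ind; split_ifs <;> first | tauto | norm_num

lemma ind_or_le (p q : Prop) : ind (p ∨ q) ≤ ind p + ind q := by
  unfold ind; split_ifs <;> first | tauto | norm_num

lemma ind_exists_le (s : Finset ι) (p : ι → Prop) :
    ind (∃ i ∈ s, p i) ≤ ∑ i ∈ s, ind (p i) := by
  by_cases h : ∃ i ∈ s, p i
  · obtain ⟨i, hi, hp⟩ := h
    calc ind (∃ i ∈ s, p i) ≤ ind (p i) := ind_mono fun _ => hp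
      _ ≤ _ := Finset.single_le_sum (f := fun i => ind (p i)) (fun _ _ => ind_nonneg _) hi
  · rw [ind, if_neg h]
    exact Finset.sum_nonneg fun _ _ => ind_nonneg _

/-- Every codebook has a decoder erring on a message only if the output is atypical for its
codeword or confusable with another codeword. -/
lemma exists_decoder [Nonempty ι] (D : X → Y → Prop) (N : X → X → Y → Prop)
    (hN : ∀ x x' y, ¬ D x y → ¬ D x' y → N x x' y ∨ N x' x y) (f : ι → X) :
    ∃ φ : Y → ι, ∀ m y, φ y ≠ m → D (f m) y ∨ ∃ m', m' ≠ m ∧ N (f m) (f m') y := by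
  have hφ : ∀ y, ∃ k, ∀ m, k ≠ m → D (f m) y ∨ ∃ m', m' ≠ m ∧ N (f m) (f m') y := by
    intro y
    by_cases h : ∃ k, ¬ D (f k) y ∧ ∀ m', m' ≠ k → ¬ N (f k) (f m') y
    · obtain ⟨k, hkD, hkN⟩ := h
      refine ⟨k, fun m hkm => or_iff_not_imp_left.mpr fun hmD => ⟨k, hkm, ?_⟩⟩
      exact (hN _ _ _ hmD hkD).resolve_right (hkN m hkm.symm)
    · push Not at h
      exact ⟨Classical.arbitrary ι, fun m _ => or_iff_not_imp_left.mpr (h m)⟩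
  choose φ hφ using hφ
  exact ⟨φ, fun m y => hφ y m⟩

variable [Fintype Y]

lemma IsDist.sum_mul_ind_mem_Icc {V : Y → ℝ} (hV : IsDist V) (p : Y → Prop) :
    ∑ y, V y * ind (p y) ∈ Set.Icc (0 : ℝ) 1 := by
  refine ⟨Finset.sum_nonneg fun y _ => mul_nonneg (hV.1 y) (ind_nonneg _), ?_⟩
  calc ∑ y, V y * ind (p y) ≤ ∑ y, V y :=
        Finset.sum_le_sum fun y _ => mul_le_of_le_one_right (hV.1 y) (ind_le_one _)
    _ = 1 := hV.2

/-- The probability, under the channel `V` with input `f i`, that the output falls into the bad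
set `D` or is confusable through `N` with a codeword preceding `f i`. -/
def precErr [LT ι] (V : X → Y → ℝ) (D : X → Y → Prop) (N : X → X → Y → Prop) (i : ι)
    (f : ι → X) : ℝ :=
  ∑ y, V (f i) y * ind (D (f i) y ∨ ∃ j, j < i ∧ N (f i) (f j) y)

lemma precErr_congr [PartialOrder ι] (V : X → Y → ℝ) (D : X → Y → Prop)
    (N : X → X → Y → Prop) {i : ι} {f f' : ι → X} (h : ∀ j ≤ i, f j = f' j) :
    precErr V D N i f = precErr V D N i f' := by
  unfold precErr
  rw [h i le_rfl]
  refine Finset.sum_congr rfl fun y _ => ?_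
  have : (∃ j, j < i ∧ N (f' i) (f j) y) ↔ ∃ j, j < i ∧ N (f' i) (f' j) y :=
    exists_congr fun j => and_congr_right fun hj => by rw [h j hj.le]
  rw [this]

variable [Fintype ι]

/-- Linear form of the Chernoff estimate, valid also when the range bound `b` vanishes. -/
lemma sum_le_of_sum_log_le (B : X → ℝ) {b m L : ℝ} (hB : ∀ x, B x ∈ Set.Icc 0 b)
    (hm : 0 ≤ m) (hb : 0 ≤ b) (f : ι → X)
    (h : ∑ i, (Real.log 2 * B (f i) / b - m / b) ≤ L) :
    Real.log 2 * ∑ i, B (f i) ≤ Fintype.card ι * m + b * L := by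
  rcases hb.eq_or_lt with rfl | hb
  · have : ∀ i, B (f i) = 0 := fun i => le_antisymm (hB _).2 (hB _).1
    simp only [this, Finset.sum_const_zero, mul_zero, zero_mul, add_zero]
    positivity
  · rw [Finset.sum_sub_distrib, ← Finset.sum_div, ← Finset.mul_sum, Finset.sum_const,
      Finset.card_univ, nsmul_eq_mul, mul_div_assoc', ← sub_div, div_le_iff₀ hb] at h
    linarith

variable [Fintype κ] [Fintype X] [Fintype Θ]

lemma isDist_pi [DecidableEq ι] {p : ι → X → ℝ} (hp : ∀ i, IsDist (p i)) :
    IsDist fun f : ι → X => ∏ i, p i (f i) := by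
  refine ⟨fun f => Finset.prod_nonneg fun i _ => (hp i).1 _, ?_⟩
  rw [← Fintype.prod_sum]
  exact Finset.prod_eq_one fun i _ => (hp i).2

/-- Redrawing one coordinate of an i.i.d. sequence does not change an expectation. -/
lemma sum_prod_mul_update [DecidableEq ι] {P : X → ℝ} (hP : IsDist P) (k : ι)
    (F : (ι → X) → ℝ) :
    ∑ f : ι → X, (∏ i, P (f i)) * F f =
      ∑ f : ι → X, (∏ i, P (f i)) * ∑ x, P x * F (Function.update f k x) := by
  have hinv : Function.Involutive
      (fun q : (ι → X) × X => (Function.update q.1 k q.2, q.1 k)) := by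
    rintro ⟨f, x⟩; simp
  calc ∑ f : ι → X, (∏ i, P (f i)) * F f
      = ∑ f : ι → X, ∑ x, (∏ i, P (f i)) * P x * F f := by
        refine Finset.sum_congr rfl fun f _ => ?_
        rw [← Finset.sum_mul, ← Finset.mul_sum, hP.2, mul_one]
    _ = ∑ q : (ι → X) × X, (∏ i, P (q.1 i)) * P q.2 * F q.1 := by
        rw [Fintype.sum_prod_type]
    _ = ∑ q : (ι → X) × X, (∏ i, P (q.1 i)) * P q.2 * F (Function.update q.1 k q.2) := by
        rw [← Equiv.sum_comp (hinv.toPerm _)]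
        refine Finset.sum_congr rfl fun q _ => ?_
        simp only [Function.Involutive.coe_toPerm]
        congr 1
        rw [← Finset.mul_prod_erase _ _ (Finset.mem_univ k),
          ← Finset.mul_prod_erase Finset.univ (fun i => P (q.1 i)) (Finset.mem_univ k)]
        have : ∏ i ∈ Finset.univ.erase k, P (Function.update q.1 k q.2 i) =
            ∏ i ∈ Finset.univ.erase k, P (q.1 i) :=
          Finset.prod_congr rfl fun i hi => by
            rw [Function.update_of_ne (Finset.ne_of_mem_erase hi)]
        rw [this, Function.update_self]
        ring
    _ = _ := by
        rw [Fintype.sum_prod_type]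
        refine Finset.sum_congr rfl fun f _ => ?_
        rw [Finset.mul_sum]
        exact Finset.sum_congr rfl fun x _ => mul_assoc _ _ _

/-- A product of adapted nonnegative factors, each of conditional mean at most one given the
past, has mean at most one. -/
lemma sum_prod_mul_prod_le_one [LinearOrder ι] {P : X → ℝ} (hP : IsDist P)
    (g : ι → (ι → X) → ℝ) (hg0 : ∀ i f, 0 ≤ g i f)
    (hadapted : ∀ i j, i < j → ∀ f x, g i (Function.update f j x) = g i f)
    (hmean : ∀ i f, ∑ x, P x * g i (Function.update f i x) ≤ 1) :
    ∑ f : ι → X, (∏ i, P (f i)) * ∏ i, g i f ≤ 1 := by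
  have key : ∀ s : Finset ι, ∑ f : ι → X, (∏ i, P (f i)) * ∏ i ∈ s, g i f ≤ 1 := by
    intro s
    induction s using Finset.induction_on_max with
    | empty => simpa using (isDist_pi fun _ : ι => hP).2.le
    | insert a s ha ih =>
      have has : a ∉ s := fun h => lt_irrefl _ (ha a h)
      refine le_trans ?_ ih
      rw [sum_prod_mul_update hP a]
      refine Finset.sum_le_sum fun f _ => ?_
      refine mul_le_mul_of_nonneg_left ?_ (Finset.prod_nonneg fun i _ => hP.1 _)
      have hs : ∀ x, ∏ i ∈ insert a s, g i (Function.update f a x) =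
          (∏ i ∈ s, g i f) * g a (Function.update f a x) := fun x => by
        rw [Finset.prod_insert has, mul_comm,
          Finset.prod_congr rfl fun i hi => hadapted i a (ha i hi) f x]
      calc ∑ x, P x * ∏ i ∈ insert a s, g i (Function.update f a x)
          = (∏ i ∈ s, g i f) * ∑ x, P x * g a (Function.update f a x) := by
            rw [Finset.mul_sum]
            exact Finset.sum_congr rfl fun x _ => by rw [hs]; ring
        _ ≤ ∏ i ∈ s, g i f :=
            mul_le_of_le_one_right (Finset.prod_nonneg fun i _ => hg0 i f) (hmean a f)
  exact key Finset.univ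

/-- The Hoeffding lemma for a probability mass function on a finite type. -/
lemma sum_mul_exp_centered_le {P : X → ℝ} (hP : IsDist P) (v : X → ℝ)
    (hv : ∀ x, v x ∈ Set.Icc (0 : ℝ) 1) (l : ℝ) :
    ∑ x, P x * Real.exp (l * (v x - ∑ x', P x' * v x')) ≤ Real.exp (l ^ 2 / 8) := by
  let _ : MeasurableSpace X := ⊤
  let p : PMF X := PMF.ofFintype (fun x => ENNReal.ofReal (P x)) (by
    rw [← ENNReal.ofReal_sum_of_nonneg fun x _ => hP.1 x, hP.2, ENNReal.ofReal_one])
  have hp : ∀ x, (p x).toReal = P x := fun x => by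
    simp [p, PMF.ofFintype_apply, ENNReal.toReal_ofReal (hP.1 x)]
  have hint : ∀ F : X → ℝ, ∫ x, F x ∂p.toMeasure = ∑ x, P x * F x := fun F => by
    rw [PMF.integral_eq_sum]
    simp [hp]
  have h := (ProbabilityTheory.hasSubgaussianMGF_of_mem_Icc (μ := p.toMeasure) (X := v)
    (measurable_of_finite v).aemeasurable (Eventually.of_forall hv)).mgf_le l
  rw [ProbabilityTheory.mgf, hint, hint] at h
  refine h.trans (le_of_eq ?_)
  congr 1
  push_cast
  norm_num
  ring

/-- Finitely many nonnegative functions of mean at most one are simultaneously bounded by their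
number at some point. -/
lemma exists_forall_le_card {Ω : Type*} [Fintype Ω] {p : Ω → ℝ} (hp : IsDist p)
    (h : κ → Ω → ℝ) (h0 : ∀ k ω, 0 ≤ h k ω) (hmean : ∀ k, ∑ ω, p ω * h k ω ≤ 1) :
    ∃ ω, ∀ k, h k ω ≤ Fintype.card κ := by
  have hsum : ∑ ω, p ω * ∑ k, h k ω ≤ ∑ ω, p ω * (Fintype.card κ : ℝ) := by
    rw [← Finset.sum_mul, hp.2, one_mul]
    simp_rw [Finset.mul_sum]
    rw [Finset.sum_comm]
    calc ∑ k, ∑ ω, p ω * h k ω ≤ ∑ _k : κ, (1 : ℝ) := Finset.sum_le_sum fun k _ => hmean k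
      _ = Fintype.card κ := by simp
  by_contra! hcon
  have hlt : ∀ ω, (Fintype.card κ : ℝ) < ∑ k, h k ω := fun ω => by
    obtain ⟨k, hk⟩ := hcon ω
    exact hk.trans_le (Finset.single_le_sum (f := fun k => h k ω) (fun k _ => h0 k ω)
      (Finset.mem_univ k))
  have hzero : ∀ ω, p ω = 0 := fun ω => by
    by_contra hne
    refine absurd hsum (not_le.mpr (Finset.sum_lt_sum
      (fun ω _ => mul_le_mul_of_nonneg_left (hlt ω).le (hp.1 ω))
      ⟨ω, Finset.mem_univ ω, mul_lt_mul_of_pos_left (hlt ω) ((hp.1 ω).lt_of_ne' hne)⟩))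
  simpa [hzero] using hp.2

/-- The probability that a random codeword is confusable with a fixed codeword. -/
def confProb (P : X → ℝ) (V : X → Y → ℝ) (N : X → X → Y → Prop) (x' : X) : ℝ :=
  ∑ x, ∑ y, P x * V x y * ind (N x x' y)

lemma confProb_nonneg {P : X → ℝ} (hP : IsDist P) {V : X → Y → ℝ} (hV : ∀ x, IsDist (V x))
    (N : X → X → Y → Prop) (x' : X) : 0 ≤ confProb P V N x' :=
  Finset.sum_nonneg fun x _ => Finset.sum_nonneg fun y _ =>
    mul_nonneg (mul_nonneg (hP.1 x) ((hV x).1 y)) (ind_nonneg _)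

/-- Exponential moment bound for the total error due to preceding codewords, centred at an upper
bound for its conditional means. -/
lemma sum_prod_mul_exp_precErr_le [LinearOrder ι] {P : X → ℝ} (hP : IsDist P)
    {V : X → Y → ℝ} (hV : ∀ x, IsDist (V x)) (D : X → Y → Prop) (N : X → X → Y → Prop)
    {l : ℝ} (hl : 0 ≤ l) :
    ∑ f : ι → X, (∏ i, P (f i)) * Real.exp (∑ i, (l * (precErr V D N i f -
      ((∑ x, ∑ y, P x * V x y * ind (D x y)) +
        ∑ j with j < i, confProb P V N (f j))) - l ^ 2 / 8)) ≤ 1 := by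
  simp_rw [Real.exp_sum]
  refine sum_prod_mul_prod_le_one hP (fun i f => Real.exp (l * (precErr V D N i f -
      ((∑ x, ∑ y, P x * V x y * ind (D x y)) +
        ∑ j with j < i, confProb P V N (f j))) - l ^ 2 / 8))
    (fun _ _ => (Real.exp_pos _).le) ?_ ?_
  · intro i j hij f x
    have h1 : precErr V D N i (Function.update f j x) = precErr V D N i f :=
      precErr_congr V D N fun k hk => Function.update_of_ne (hk.trans_lt hij).ne _ _
    have h2 : ∑ k with k < i, confProb P V N (Function.update f j x k) =
        ∑ k with k < i, confProb P V N (f k) :=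
      Finset.sum_congr rfl fun k hk => by
        rw [Function.update_of_ne ((Finset.mem_filter.mp hk).2.trans hij).ne]
    simp only [h1, h2]
  · intro i f
    set c := (∑ x, ∑ y, P x * V x y * ind (D x y)) +
        ∑ j with j < i, confProb P V N (f j) with hc
    set v : X → ℝ := fun x => precErr V D N i (Function.update f i x) with hv
    have hvx : ∀ x, v x = ∑ y, V x y * ind (D x y ∨ ∃ j, j < i ∧ N x (f j) y) := by
      intro x
      simp only [hv, precErr, Function.update_self]
      refine Finset.sum_congr rfl fun y _ => ?_
      have : (∃ j, j < i ∧ N x (Function.update f i x j) y) ↔ ∃ j, j < i ∧ N x (f j) y :=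
        exists_congr fun j => and_congr_right fun hj => by rw [Function.update_of_ne hj.ne]
      rw [this]
    have hc' : ∀ x, ∑ j with j < i, confProb P V N (Function.update f i x j) =
        ∑ j with j < i, confProb P V N (f j) := fun x =>
      Finset.sum_congr rfl fun k hk => by
        rw [Function.update_of_ne (Finset.mem_filter.mp hk).2.ne]
    have hmean : ∑ x, P x * v x ≤ c := by
      have hpt : ∀ x y, ind (D x y ∨ ∃ j, j < i ∧ N x (f j) y) ≤
          ind (D x y) + ∑ j with j < i, ind (N x (f j) y) := fun x y => by
        refine (ind_or_le _ _).trans (add_le_add_right ?_ _)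
        refine le_trans (ind_mono ?_) (ind_exists_le _ _)
        simp
      calc ∑ x, P x * v x
          ≤ ∑ x, ∑ y, P x * V x y * (ind (D x y) + ∑ j with j < i, ind (N x (f j) y)) := by
            refine Finset.sum_le_sum fun x _ => ?_
            rw [hvx, Finset.mul_sum]
            refine Finset.sum_le_sum fun y _ => ?_
            rw [← mul_assoc]
            exact mul_le_mul_of_nonneg_left (hpt x y) (mul_nonneg (hP.1 x) ((hV x).1 y))
        _ = c := by
            simp only [hc, mul_add, Finset.sum_add_distrib, confProb, Finset.mul_sum]
            congr 1
            rw [Finset.sum_comm (s := Finset.univ.filter (· < i))]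
            exact Finset.sum_congr rfl fun x _ => Finset.sum_comm
    have hv01 : ∀ x, v x ∈ Set.Icc (0 : ℝ) 1 := fun x => by
      rw [hvx]
      exact (hV x).sum_mul_ind_mem_Icc _
    simp only [hc']
    rw [← hc]
    calc ∑ x, P x * Real.exp (l * (v x - c) - l ^ 2 / 8)
        ≤ ∑ x, P x * Real.exp (l * (v x - ∑ x', P x' * v x')) * Real.exp (-(l ^ 2 / 8)) := by
          refine Finset.sum_le_sum fun x _ => ?_
          rw [mul_assoc, ← Real.exp_add]
          refine mul_le_mul_of_nonneg_left (Real.exp_le_exp.mpr ?_) (hP.1 x)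
          nlinarith
      _ = (∑ x, P x * Real.exp (l * (v x - ∑ x', P x' * v x'))) * Real.exp (-(l ^ 2 / 8)) :=
          (Finset.sum_mul _ _ _).symm
      _ ≤ Real.exp (l ^ 2 / 8) * Real.exp (-(l ^ 2 / 8)) :=
          mul_le_mul_of_nonneg_right (sum_mul_exp_centered_le hP v hv01 l) (Real.exp_pos _).le
      _ = 1 := by rw [← Real.exp_add]; simp

/-- Multiplicative Chernoff bound, base two: exponential moment of a sum of i.i.d. variables
valued in `[0, b]`. -/
lemma sum_prod_mul_exp_le_one [DecidableEq ι] {P : X → ℝ} (hP : IsDist P) (B : X → ℝ) {b : ℝ}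
    (hB : ∀ x, B x ∈ Set.Icc 0 b) :
    ∑ f : ι → X, (∏ i, P (f i)) * Real.exp (∑ i, (Real.log 2 * B (f i) / b -
      (∑ x, P x * B x) / b)) ≤ 1 := by
  have hone : ∑ x, P x * Real.exp (Real.log 2 * B x / b - (∑ x, P x * B x) / b) ≤ 1 := by
    set m := (∑ x, P x * B x) / b with hm
    have hpt : ∀ x, Real.exp (Real.log 2 * B x / b) ≤ 1 + B x / b := fun x => by
      have hb : 0 ≤ b := (hB x).1.trans (hB x).2
      have := rpow_one_add_le_one_add_mul_self (s := 1) (p := B x / b) (by norm_num)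
        (div_nonneg (hB x).1 hb) (div_le_one_of_le₀ (hB x).2 hb)
      rw [Real.rpow_def_of_pos (by norm_num)] at this
      norm_num at this
      rwa [mul_div_assoc]
    calc ∑ x, P x * Real.exp (Real.log 2 * B x / b - m)
        ≤ ∑ x, P x * (1 + B x / b) * Real.exp (-m) := by
          refine Finset.sum_le_sum fun x _ => ?_
          rw [sub_eq_add_neg, Real.exp_add, mul_assoc]
          exact mul_le_mul_of_nonneg_left
            (mul_le_mul_of_nonneg_right (hpt x) (Real.exp_pos _).le) (hP.1 x)
      _ = (m + 1) * Real.exp (-m) := by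
          rw [← Finset.sum_mul]
          congr 1
          simp only [mul_add, mul_one, Finset.sum_add_distrib, hP.2, hm, Finset.sum_div,
            mul_div_assoc]
          exact add_comm _ _
      _ ≤ Real.exp m * Real.exp (-m) :=
          mul_le_mul_of_nonneg_right (Real.add_one_le_exp m) (Real.exp_pos _).le
      _ = 1 := by rw [← Real.exp_add]; simp
  simp_rw [Real.exp_sum, ← Finset.prod_mul_distrib]
  rw [← Fintype.prod_sum (fun (_ : ι) x => P x *
    Real.exp (Real.log 2 * B x / b - (∑ x, P x * B x) / b))]
  exact Finset.prod_le_one (fun _ _ => Finset.sum_nonneg fun x _ =>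
    mul_nonneg (hP.1 x) (Real.exp_pos _).le) fun _ _ => hone

/-- From an exponent bound to a bound on the total error due to preceding codewords. -/
lemma sum_precErr_le [LinearOrder ι] {P : X → ℝ} (hP : IsDist P)
    {V : X → Y → ℝ} (hV : ∀ x, IsDist (V x)) (D : X → Y → Prop) (N : X → X → Y → Prop)
    (f : ι → X) {r L : ℝ} (hr : 0 < r) (hrL : Fintype.card ι * r ^ 2 = 2 * L)
    (h : ∑ i, (2 * r * (precErr V D N i f -
      ((∑ x, ∑ y, P x * V x y * ind (D x y)) +
        ∑ j with j < i, confProb P V N (f j))) - (2 * r) ^ 2 / 8) ≤ L) :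
    ∑ i, precErr V D N i f ≤ Fintype.card ι *
      ((∑ x, ∑ y, P x * V x y * ind (D x y)) + ∑ i, confProb P V N (f i) + r / 2) := by
  have hS : ∑ i, ∑ j with j < i, confProb P V N (f j) ≤
      Fintype.card ι * ∑ i, confProb P V N (f i) := by
    calc ∑ i, ∑ j with j < i, confProb P V N (f j)
        ≤ ∑ _i : ι, ∑ j, confProb P V N (f j) :=
          Finset.sum_le_sum fun i _ => Finset.sum_le_sum_of_subset_of_nonneg
            (Finset.filter_subset _ _) fun j _ _ => confProb_nonneg hP hV N _
      _ = _ := by simp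
  simp only [Finset.sum_sub_distrib, ← Finset.mul_sum, Finset.sum_add_distrib, Finset.sum_const,
    Finset.card_univ, nsmul_eq_mul] at h
  refine le_of_mul_le_mul_left ?_ (mul_pos two_pos hr)
  nlinarith [mul_le_mul_of_nonneg_left hS (mul_pos two_pos hr).le]

/-- Random coding bound for a finite family of channels and a fixed codeword distribution. -/
lemma exists_code_error_le [Nonempty Θ] {V : Θ → X → Y → ℝ} (hV : ∀ θ x, IsDist (V θ x))
    {M : ℕ} (hM : 0 < M) (D : X → Y → Prop) (N : X → X → Y → Prop)
    (hN : ∀ x x' y, ¬ D x y → ¬ D x' y → N x x' y ∨ N x' x y) {P : X → ℝ} (hP : IsDist P) :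
    ∃ (f : Fin M → X) (φ : Y → Fin M), ∀ θ,
      (1 / (M : ℝ)) * ∑ m, ∑ y, ind (φ y ≠ m) * V θ (f m) y ≤
        Real.sqrt (2 * Real.log (3 * (Fintype.card Θ : ℝ)) / M) +
        ((∑ x, ∑ y, P x * V θ x y * ind (D x y)) +
          2 * Real.logb 2 (3 * (Fintype.card Θ : ℝ)) * (⨆ x', confProb P (V θ) N x') +
          2 * (M : ℝ) * Real.logb 2 (Real.exp 1) * ∑ x, P x * confProb P (V θ) N x) := by
  set L := Real.log (3 * (Fintype.card Θ : ℝ)) with hL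
  have hK : (1 : ℝ) ≤ Fintype.card Θ := by exact_mod_cast Fintype.card_pos
  have hLpos : 0 < L := Real.log_pos (by linarith)
  have hM' : (0 : ℝ) < M := by exact_mod_cast hM
  set r := Real.sqrt (2 * L / M) with hr
  have hrpos : 0 < r := Real.sqrt_pos.mpr (by positivity)
  have hrL : (M : ℝ) * r ^ 2 = 2 * L := by
    rw [hr, Real.sq_sqrt (by positivity)]
    field_simp
  have hB : ∀ θ x, confProb P (V θ) N x ∈ Set.Icc 0 (⨆ x', confProb P (V θ) N x') :=
    fun θ x => ⟨confProb_nonneg hP (hV θ) N x,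
      le_ciSup (f := fun x' => confProb P (V θ) N x') (Set.finite_range _).bddAbove x⟩
  let e : Θ × Fin 3 → (Fin M → X) → ℝ := fun q f =>
    ![∑ i, (Real.log 2 * confProb P (V q.1) N (f i) / (⨆ x', confProb P (V q.1) N x') -
        (∑ x, P x * confProb P (V q.1) N x) / (⨆ x', confProb P (V q.1) N x')),
      ∑ i, (2 * r * (precErr (V q.1) D N i f -
        ((∑ x, ∑ y, P x * V q.1 x y * ind (D x y)) +
          ∑ j with j < i, confProb P (V q.1) N (f j))) - (2 * r) ^ 2 / 8),
      ∑ i : (Fin M)ᵒᵈ, (2 * r * (precErr (ι := (Fin M)ᵒᵈ) (V q.1) (fun _ _ => False) N i f -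
        ((∑ x, ∑ y, P x * V q.1 x y * ind False) +
          ∑ j : (Fin M)ᵒᵈ with j < i, confProb P (V q.1) N (f j))) - (2 * r) ^ 2 / 8)] q.2
  obtain ⟨f, hf⟩ := exists_forall_le_card (isDist_pi fun _ : Fin M => hP)
    (fun q f => Real.exp (e q f)) (fun _ _ => (Real.exp_pos _).le) (by
      rintro ⟨θ, k⟩
      fin_cases k
      · exact sum_prod_mul_exp_le_one hP _ (hB θ)
      · exact sum_prod_mul_exp_precErr_le hP (hV θ) D N (by positivity)
      · exact sum_prod_mul_exp_precErr_le (ι := (Fin M)ᵒᵈ) hP (hV θ) (fun _ _ => False) N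
          (by positivity))
  have he : ∀ q, e q f ≤ L := fun q => by
    rw [hL, Real.le_log_iff_exp_le (by positivity)]
    refine (hf q).trans (le_of_eq ?_)
    simp [Fintype.card_prod, mul_comm]
  have : Nonempty (Fin M) := ⟨⟨0, hM⟩⟩
  obtain ⟨φ, hφ⟩ := exists_decoder D N hN f
  refine ⟨f, φ, fun θ => ?_⟩
  set β := ⨆ x', confProb P (V θ) N x' with hβ
  set S := ∑ i, confProb P (V θ) N (f i) with hS
  set a := ∑ x, ∑ y, P x * V θ x y * ind (D x y) with ha
  set c := ∑ x, P x * confProb P (V θ) N x with hc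
  have hc0 : 0 ≤ c := Finset.sum_nonneg fun x _ => mul_nonneg (hP.1 x) (hB θ x).1
  have h1 : Real.log 2 * S ≤ M * c + β * L := by
    have := sum_le_of_sum_log_le _ (hB θ) hc0
      ((hB θ (f ⟨0, hM⟩)).1.trans (hB θ (f ⟨0, hM⟩)).2) f (he (θ, 0))
    rwa [Fintype.card_fin] at this
  have h2 : ∑ i, precErr (V θ) D N i f ≤ M * (a + S + r / 2) := by
    have := sum_precErr_le hP (hV θ) D N f hrpos (by rwa [Fintype.card_fin]) (he (θ, 1))
    rwa [Fintype.card_fin] at this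
  have h3 : ∑ i : (Fin M)ᵒᵈ, precErr (ι := (Fin M)ᵒᵈ) (V θ) (fun _ _ => False) N i f ≤
      M * (S + r / 2) := by
    have := sum_precErr_le (ι := (Fin M)ᵒᵈ) hP (hV θ) (fun _ _ => False) N f hrpos
      (by rwa [Fintype.card_orderDual, Fintype.card_fin]) (he (θ, 2))
    rw [Fintype.card_orderDual, Fintype.card_fin] at this
    have hzero : ∑ x, ∑ y, P x * V θ x y * ind False = 0 := by simp [ind]
    rw [hzero, zero_add] at this
    exact this
  have herr : ∑ m, ∑ y, ind (φ y ≠ m) * V θ (f m) y ≤ M * (a + 2 * S + r) := by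
    calc ∑ m, ∑ y, ind (φ y ≠ m) * V θ (f m) y
        ≤ ∑ m, (precErr (V θ) D N m f +
            precErr (ι := (Fin M)ᵒᵈ) (V θ) (fun _ _ => False) N (OrderDual.toDual m) f) := by
          refine Finset.sum_le_sum fun m _ => ?_
          change _ ≤ ∑ y, V θ (f m) y * ind (D (f m) y ∨ ∃ j, j < m ∧ N (f m) (f j) y) +
            ∑ y, V θ (f m) y * ind (False ∨ ∃ j, m < j ∧ N (f m) (f j) y)
          rw [← Finset.sum_add_distrib]
          refine Finset.sum_le_sum fun y _ => ?_
          rw [mul_comm, ← mul_add]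
          refine mul_le_mul_of_nonneg_left ?_ ((hV θ _).1 y)
          refine le_trans (ind_mono fun hne => ?_) (ind_or_le _ _)
          rcases hφ m y hne with hD | ⟨m', hm', hNm⟩
          · exact Or.inl (Or.inl hD)
          · rcases lt_or_gt_of_ne hm' with hlt | hgt
            · exact Or.inl (Or.inr ⟨m', hlt, hNm⟩)
            · exact Or.inr (Or.inr ⟨m', hgt, hNm⟩)
      _ ≤ M * (a + S + r / 2) + M * (S + r / 2) := by
          rw [Finset.sum_add_distrib]
          exact add_le_add h2 h3
      _ = M * (a + 2 * S + r) := by ring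
  have hlog2 : 0 < Real.log 2 := Real.log_pos (by norm_num)
  have hS' : S ≤ (M * c + β * L) / Real.log 2 := by
    rw [le_div_iff₀ hlog2]
    linarith
  calc (1 / (M : ℝ)) * ∑ m, ∑ y, ind (φ y ≠ m) * V θ (f m) y
      ≤ (1 / (M : ℝ)) * (M * (a + 2 * S + r)) :=
        mul_le_mul_of_nonneg_left herr (by positivity)
    _ = r + (a + 2 * S) := by field_simp; ring
    _ ≤ r + (a + 2 * ((M * c + β * L) / Real.log 2)) := by linarith
    _ = _ := by
        rw [Real.logb, Real.logb, Real.log_exp, ← hL]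
        ring

end RandomCode

/-- The memoryless extension of a channel is a channel. -/
lemma isDist_nCh {𝒳 𝒴 𝒯 : Type*} [Fintype 𝒴] {W : 𝒯 → 𝒳 → 𝒴 → ℝ} (hW : ∀ θ x, IsDist (W θ x)) (n : ℕ) (θ : Fin n → 𝒯)
    (x : Fin n → 𝒳) : IsDist (nCh W n θ x) :=
  isDist_pi fun i => hW (θ i) (x i)

end AVCGame

/-- Kosut–Kliewer achievability: existence of a deterministic channel
code for the AVC whose maximum-over-states average probability of error satisfies the
stated finite-blocklength bound. -/
theorem deterministic_avc_code_exists
    {𝒳 𝒴 𝒯 : Type*} [Fintype 𝒳] [Fintype 𝒴] [Fintype 𝒯]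
    [Nonempty 𝒳] [Nonempty 𝒴] [Nonempty 𝒯]
    (W : 𝒯 → 𝒳 → 𝒴 → ℝ) (hW : ∀ θ x, IsDist (W θ x))
    (n M : ℕ) (hM : 0 < M)
    (Z : (Fin n → 𝒳) → (Fin n → 𝒳) → (Fin n → 𝒴) → ℕ)
    (hZ01 : ∀ x xb y, Z x xb y = 0 ∨ Z x xb y = 1)
    (hZ : ∀ x xb y, Z x xb y * Z xb x y = 0)
    (A : Set ((Fin n → 𝒳) × (Fin n → 𝒴))) :
    ∃ (f : Fin M → Fin n → 𝒳) (φ : (Fin n → 𝒴) → Fin M),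
      (⨆ θ : Fin n → 𝒯, (1 / (M : ℝ)) *
          ∑ m : Fin M, ∑ y : Fin n → 𝒴, ind (φ y ≠ m) * nCh W n θ (f m) y)
      ≤ Real.sqrt (2 * Real.log (3 * (Fintype.card 𝒯 : ℝ) ^ n) / M)
        + ⨅ PX : ProbDist (Fin n → 𝒳), ⨆ θ : Fin n → 𝒯,
            ((∑ x : Fin n → 𝒳, ∑ y : Fin n → 𝒴,
                PX.1 x * nCh W n θ x y * ind ((x, y) ∉ A))
             + 2 * Real.logb 2 (3 * (Fintype.card 𝒯 : ℝ) ^ n) *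
                 (⨆ xb : Fin n → 𝒳, ∑ x : Fin n → 𝒳, ∑ y : Fin n → 𝒴,
                   PX.1 x * nCh W n θ x y * ind (Z x xb y = 0 ∧ (x, y) ∈ A))
             + 2 * (M : ℝ) * Real.logb 2 (Real.exp 1) *
                 (∑ x : Fin n → 𝒳, ∑ xb : Fin n → 𝒳, ∑ y : Fin n → 𝒴,
                   PX.1 x * PX.1 xb * nCh W n θ x y *
                     ind (Z x xb y = 0 ∧ (x, y) ∈ A))) := by
  have hN : ∀ x xb y, ¬ (x, y) ∉ A → ¬ (xb, y) ∉ A →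
      (Z x xb y = 0 ∧ (x, y) ∈ A) ∨ (Z xb x y = 0 ∧ (xb, y) ∈ A) := fun x xb y hx hxb =>
    (mul_eq_zero.mp (hZ x xb y)).imp (fun h => ⟨h, not_not.mp hx⟩) fun h => ⟨h, not_not.mp hxb⟩
  have : Nonempty (Fin M) := ⟨⟨0, hM⟩⟩
  obtain ⟨⟨f, φ⟩, hbest⟩ := Finite.exists_min
    fun c : (Fin M → Fin n → 𝒳) × ((Fin n → 𝒴) → Fin M) =>
      ⨆ θ : Fin n → 𝒯, (1 / (M : ℝ)) *
        ∑ m : Fin M, ∑ y : Fin n → 𝒴, ind (c.2 y ≠ m) * nCh W n θ (c.1 m) y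
  refine ⟨f, φ, ?_⟩
  have : Nonempty (ProbDist (Fin n → 𝒳)) := by
    obtain ⟨x₀⟩ : Nonempty (Fin n → 𝒳) := inferInstance
    refine ⟨⟨fun x => if x = x₀ then 1 else 0, fun x => ?_, by simp⟩⟩
    dsimp only
    split_ifs <;> norm_num
  rw [← sub_le_iff_le_add']
  refine le_ciInf fun PX => ?_
  rw [sub_le_iff_le_add']
  obtain ⟨f', φ', hcode⟩ := exists_code_error_le
    (V := fun θ : Fin n → 𝒯 => nCh W n θ) (isDist_nCh hW n) hM (fun x y => (x, y) ∉ A)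
    (fun x xb y => Z x xb y = 0 ∧ (x, y) ∈ A) hN PX.2
  refine (hbest (f', φ')).trans (ciSup_le fun θ => (hcode θ).trans ?_)
  rw [show ((Fintype.card (Fin n → 𝒯) : ℕ) : ℝ) = (Fintype.card 𝒯 : ℝ) ^ n by simp]
  refine add_le_add_right (le_trans (le_of_eq ?_) (le_ciSup (Set.finite_range _).bddAbove θ)) _
  congr 2
  rw [Finset.sum_comm (γ := Fin n → 𝒳)]
  refine Finset.sum_congr rfl fun xb _ => ?_
  simp only [confProb, Finset.mul_sum]
  refine Finset.sum_congr rfl fun x _ => Finset.sum_congr rfl fun y _ => ?_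
  ring
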